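/- arXiv:1405.5390 — 5 statements merged into one kernel-verified Lean document; each statement's English description precedes it below -/
import Mathlib

section
/- (Proposition 1, 'offers remain open') For every video v ∈ V, every station s ∈ M and every step k: if s ∈ Cv v (A v k) (i.e., v proposes to s at step k) and s does not reject v at step k (i.e., v ∈ Cs s (P s k)), then s ∈ Cv v (A v (k+1)), i.e., v again proposes to s at step k+1. -/
universe u

/-- A choice function on a finite type `α`: selects a subset of each finite set,
satisfying substitutability and irrelevance of rejected alternatives (IRC). -/
structure ChoiceFun (α : Type u) [Fintype α] [DecidableEq α] where
  C : Finset α → Finset α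
  choice_subset : ∀ S : Finset α, C S ⊆ S
  substitutable : ∀ {x : α} {S T : Finset α}, x ∈ C S → x ∈ T → T ⊆ S → x ∈ C T
  irc : ∀ {S T : Finset α}, C T ⊆ S → S ⊆ T → C S = C T

variable {M V : Type u} [Fintype M] [DecidableEq M] [Fintype V] [DecidableEq V]

/-- Proposal set of station `s` given current offer sets `A`:
the videos `v` that propose to `s`, i.e. with `s ∈ Cv v (A v)`. -/
def propSet (Cv : V → ChoiceFun M) (A : V → Finset M) (s : M) : Finset V :=
  Finset.univ.filter fun v => s ∈ (Cv v).C (A v)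

/-- Offer sets of the deferred-acceptance algorithm: `offers Cv Cs k v = A v k`. -/
def offers (Cv : V → ChoiceFun M) (Cs : M → ChoiceFun V) : ℕ → V → Finset M
  | 0 => fun _ => Finset.univ
  | k + 1 => fun v =>
      offers Cv Cs k v \
        (Finset.univ.filter fun s =>
          s ∈ (Cv v).C (offers Cv Cs k v) ∧
            v ∉ (Cs s).C (propSet Cv (offers Cv Cs k) s))

/-- Proposal set of station `s` at step `k`: `proposals Cv Cs k s = P s k`. -/
def proposals (Cv : V → ChoiceFun M) (Cs : M → ChoiceFun V) (k : ℕ) (s : M) : Finset V :=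
  propSet Cv (offers Cv Cs k) s

/-- Station `s` rejects video `v` at step `k`. -/
def rejects (Cv : V → ChoiceFun M) (Cs : M → ChoiceFun V) (k : ℕ) (s : M) (v : V) : Prop :=
  s ∈ (Cv v).C (offers Cv Cs k v) ∧ v ∉ (Cs s).C (proposals Cv Cs k s)

/-- **Proposition 1 (offers remain open).** If video `v` proposes to station `s` at step `k`
(`s ∈ Cv v (A v k)`) and `s` does not reject `v` at step `k` (`v ∈ Cs s (P s k)`),
then `v` again proposes to `s` at step `k + 1`. -/
theorem offers_remain_open (Cv : V → ChoiceFun M) (Cs : M → ChoiceFun V)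
    (v : V) (s : M) (k : ℕ)
    (hprop : s ∈ (Cv v).C (offers Cv Cs k v))
    (hkeep : v ∈ (Cs s).C (proposals Cv Cs k s)) :
    s ∈ (Cv v).C (offers Cv Cs (k + 1) v) := by
  refine (Cv v).substitutable hprop ?_ Finset.sdiff_subset
  simp only [offers, Finset.mem_sdiff, Finset.mem_filter, Finset.mem_univ, true_and, not_and,
    not_not]
  exact ⟨(Cv v).choice_subset _ hprop, fun _ => hkeep⟩
end

section
/- (Held offers remain available) For every station s ∈ M and every step k, the videos that s chooses at step k are again proposed to s at step k+1: Cs s (P s k) ⊆ P s (k+1). -/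
universe u

variable {M V : Type u} [Fintype M] [DecidableEq M] [Fintype V] [DecidableEq V]

/-- **Held offers remain available.** The videos chosen by station `s` at step `k`
are again proposed to `s` at step `k + 1`: `Cs s (P s k) ⊆ P s (k + 1)`. -/
theorem held_offers_remain_available (Cv : V → ChoiceFun M) (Cs : M → ChoiceFun V)
    (s : M) (k : ℕ) :
    (Cs s).C (proposals Cv Cs k s) ⊆ proposals Cv Cs (k + 1) s := by
  intro v hv
  have hs : s ∈ (Cv v).C (offers Cv Cs k v) :=
    (Finset.mem_filter.mp ((Cs s).choice_subset _ hv)).2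
  refine Finset.mem_filter.mpr
    ⟨Finset.mem_univ v, (Cv v).substitutable hs ?_ Finset.sdiff_subset⟩
  exact Finset.mem_sdiff.mpr
    ⟨(Cv v).choice_subset _ hs, fun h => (Finset.mem_filter.mp h).2.2 hv⟩
end

section
/- (Proposition 2, 'rejections are final') For every video v ∈ V, every station s ∈ M and every step k: if s rejects v at step k (i.e., s ∈ Cv v (A v k) and v ∉ Cs s (P s k)), then for every step p ≥ k we have v ∉ Cs s (P s p ∪ {v}). -/
universe u

variable {M V : Type u} [Fintype M] [DecidableEq M] [Fintype V] [DecidableEq V]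

/-- A video held by a station at step `k` proposes to it again at step `k + 1`. -/
theorem choice_proposals_subset_proposals_succ (Cv : V → ChoiceFun M) (Cs : M → ChoiceFun V)
    (k : ℕ) (s : M) : (Cs s).C (proposals Cv Cs k s) ⊆ proposals Cv Cs (k + 1) s := by
  intro w hw
  have hs : s ∈ (Cv w).C (offers Cv Cs k w) := by
    simpa [proposals, propSet] using (Cs s).choice_subset _ hw
  have hoffer : s ∈ offers Cv Cs (k + 1) w :=
    Finset.mem_sdiff.2 ⟨(Cv w).choice_subset _ hs, fun h => (Finset.mem_filter.1 h).2.2 hw⟩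
  exact Finset.mem_filter.2
    ⟨Finset.mem_univ _, (Cv w).substitutable hs hoffer Finset.sdiff_subset⟩

/-- An alternative rejected alongside `P` is rejected alongside any `Q` that contains
everything chosen from `P`. -/
theorem ChoiceFun.notMem_choice_union_singleton {α : Type u} [Fintype α] [DecidableEq α]
    (F : ChoiceFun α) {P Q : Finset α} {v : α} (hPQ : F.C P ⊆ Q)
    (hv : v ∉ F.C (P ∪ {v})) : v ∉ F.C (Q ∪ {v}) := by
  have hchosen : F.C (P ∪ {v}) ⊆ P := by
    intro w hw
    rcases Finset.mem_union.1 (F.choice_subset _ hw) with h | h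
    · exact h
    · exact absurd (Finset.mem_singleton.1 h ▸ hw) hv
  have hP : F.C P = F.C (P ∪ {v}) := F.irc hchosen Finset.subset_union_left
  have hsub : P ∪ {v} ⊆ P ∪ (Q ∪ {v}) :=
    Finset.union_subset_union_right Finset.subset_union_right
  have hQ : F.C (Q ∪ {v}) = F.C (P ∪ (Q ∪ {v})) := by
    refine F.irc (fun w hw => ?_) Finset.subset_union_right
    rcases Finset.mem_union.1 (F.choice_subset _ hw) with h | h
    · have hwP := F.substitutable hw (Finset.mem_union_left {v} h) hsub
      exact Finset.mem_union_left _ (hPQ (hP ▸ hwP))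
    · exact h
  intro h
  exact hv (F.substitutable (hQ ▸ h) (by simp) hsub)

/-- **Proposition 2 (rejections are final).** If station `s` rejects video `v` at step `k`,
then at every step `p ≥ k` we have `v ∉ Cs s (P s p ∪ {v})`. -/
theorem rejections_are_final (Cv : V → ChoiceFun M) (Cs : M → ChoiceFun V)
    (v : V) (s : M) (k : ℕ)
    (hprop : s ∈ (Cv v).C (offers Cv Cs k v))
    (hrej : v ∉ (Cs s).C (proposals Cv Cs k s)) :
    ∀ p : ℕ, k ≤ p → v ∉ (Cs s).C (proposals Cv Cs p s ∪ {v}) := by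
  intro p hp
  induction p, hp using Nat.le_induction with
  | base =>
    have hmem : v ∈ proposals Cv Cs k s := Finset.mem_filter.2 ⟨Finset.mem_univ _, hprop⟩
    rwa [Finset.union_eq_left.2 (Finset.singleton_subset_iff.2 hmem)]
  | succ p _ ih =>
    exact (Cs s).notMem_choice_union_singleton
      (choice_proposals_subset_proposals_succ Cv Cs p s) ih
end

section
/- (Termination of the algorithm) There exists a step K such that for every k ≥ K and every video v ∈ V, A v k = A v K; in particular, no rejection occurs at any step k ≥ K (i.e., for all v ∈ V and s ∈ M, s ∈ Cv v (A v k) implies v ∈ Cs s (P s k)). -/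
universe u

variable {M V : Type u} [Fintype M] [DecidableEq M] [Fintype V] [DecidableEq V]

theorem offers_succ_subset (Cv : V → ChoiceFun M) (Cs : M → ChoiceFun V) (k : ℕ) (v : V) :
    offers Cv Cs (k + 1) v ⊆ offers Cv Cs k v :=
  Finset.sdiff_subset

theorem offers_antitone (Cv : V → ChoiceFun M) (Cs : M → ChoiceFun V) :
    Antitone (offers Cv Cs) :=
  antitone_nat_of_succ_le fun k v => offers_succ_subset Cv Cs k v

/-- A station that rejects a video is removed from its offer set. -/
theorem notMem_offers_succ_of_rejects {Cv : V → ChoiceFun M} {Cs : M → ChoiceFun V} {k : ℕ}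
    {s : M} {v : V} (h : rejects Cv Cs k s v) : s ∉ offers Cv Cs (k + 1) v := fun hs =>
  (Finset.mem_sdiff.mp hs).2 (Finset.mem_filter.mpr ⟨Finset.mem_univ s, h⟩)

/-- **Termination of the algorithm.** There is a step `K` after which the offer sets never
change; in particular, no rejection occurs at any step `k ≥ K`. -/
theorem algorithm_terminates (Cv : V → ChoiceFun M) (Cs : M → ChoiceFun V) :
    ∃ K : ℕ, ∀ k : ℕ, K ≤ k →
      (∀ v : V, offers Cv Cs k v = offers Cv Cs K v) ∧
      (∀ (v : V) (s : M),
        s ∈ (Cv v).C (offers Cv Cs k v) → v ∈ (Cs s).C (proposals Cv Cs k s)) := by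
  obtain ⟨K, hK⟩ := WellFoundedGT.monotone_chain_condition
    (⟨fun k => OrderDual.toDual (offers Cv Cs k), fun _ _ h => offers_antitone Cv Cs h⟩ :
      ℕ →o (V → Finset M)ᵒᵈ)
  have hconst : ∀ k, K ≤ k → offers Cv Cs k = offers Cv Cs K := fun k hk => (hK k hk).symm
  refine ⟨K, fun k hk => ⟨congrFun (hconst k hk), fun v s hs => ?_⟩⟩
  by_contra hv
  have hstep : offers Cv Cs (k + 1) = offers Cv Cs k :=
    (hconst (k + 1) (Nat.le_succ_of_le hk)).trans (hconst k hk).symm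
  have hrej := notMem_offers_succ_of_rejects (Cv := Cv) (Cs := Cs) ⟨hs, hv⟩
  rw [hstep] at hrej
  exact hrej ((Cv v).choice_subset _ hs)
end

section
/- (Unchosen alternatives are not chosen from the choice set) Let C be a choice function on a finite type α (satisfying C S ⊆ S, substitutability, and IRC). For every finite set S and every element x, if x ∉ C (insert x S), then x ∉ C (insert x (C S)). -/
universe u

/-- **Unchosen alternatives are not chosen from the choice set.** If `x` is not chosen
from `insert x S`, then `x` is not chosen from `insert x (C S)` either. -/
theorem not_chosen_from_choice_set {α : Type u} [Fintype α] [DecidableEq α]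
    (C : ChoiceFun α) (S : Finset α) (x : α)
    (hx : x ∉ C.C (insert x S)) :
    x ∉ C.C (insert x (C.C S)) := by
  have hS : C.C S = C.C (insert x S) :=
    C.irc ((Finset.subset_insert_iff_of_notMem hx).1 (C.choice_subset _))
      (Finset.subset_insert x S)
  have hT : C.C (insert x (C.C S)) = C.C (insert x S) :=
    C.irc (hS ▸ Finset.subset_insert x (C.C S))
      (Finset.insert_subset_insert x (C.choice_subset S))
  rwa [hT]
end
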